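/- Let Z = m_0P_0 + m_1P_1 + m_2P_2 be a fat point scheme at three noncollinear points (taken to be the coordinate points) of P^N with m_0 ≤ m_1 ≤ m_2. If m_0 + m_1 > m_2 and m_0 + m_1 + m_2 is odd, then ρ(I(Z)) ≥ (m_0 + m_1 + m_2 + 1)/(m_0 + m_1 + m_2). -/

import Mathlib

/-- The ideal of the `j`-th coordinate point of `P^N`, generated by all
variables `x_i` with `i ≠ j`. -/
noncomputable def ptIdeal (K : Type*) [Field K] (N : ℕ) (j : Fin (N + 1)) :
    Ideal (MvPolynomial (Fin (N + 1)) K) :=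
  Ideal.span {f | ∃ i : Fin (N + 1), i ≠ j ∧ f = MvPolynomial.X i}

/-- The resurgence `ρ(I) = sup { m/r : I^{(m)} ⊄ I^r }` of an ideal `I` whose
`m`-th symbolic power is `symb m`. -/
noncomputable def resurgence {R : Type*} [CommRing R] (I : Ideal R) (symb : ℕ → Ideal R) : ℝ :=
  sSup {x : ℝ | ∃ m r : ℕ, 0 < m ∧ 0 < r ∧ ¬ symb m ≤ I ^ r ∧ x = (m : ℝ) / (r : ℝ)}

open MvPolynomial in
/-- The polynomials all of whose monomials have `w`-weight at least `n`. -/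
noncomputable def weightIdeal (K : Type*) [Field K] {σ : Type*} [Fintype σ] (w : σ → ℕ) (n : ℕ) :
    Ideal (MvPolynomial σ K) where
  carrier := {f | ∀ a ∈ f.support, n ≤ ∑ i, a i * w i}
  zero_mem' := by simp
  add_mem' := by
    classical
    intro f g hf hg a ha
    rcases Finset.mem_union.1 (support_add ha) with h | h
    exacts [hf a h, hg a h]
  smul_mem' := by
    classical
    intro c f hf a ha
    obtain ⟨b, -, d, hd, rfl⟩ := Finset.mem_add.1 (support_mul c f ha)
    refine (hf d hd).trans (Finset.sum_le_sum fun i _ => ?_)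
    exact Nat.mul_le_mul_right _ (by simp)

section weightIdeal

open MvPolynomial

variable {K : Type*} [Field K] {σ : Type*} [Fintype σ]

theorem weightIdeal_mul_le (w : σ → ℕ) (m n : ℕ) :
    weightIdeal K w m * weightIdeal K w n ≤ weightIdeal K w (m + n) := by
  classical
  refine Ideal.mul_le.2 fun f hf g hg a ha => ?_
  obtain ⟨b, hb, d, hd, rfl⟩ := Finset.mem_add.1 (support_mul f g ha)
  have := add_le_add (hf b hb) (hg d hd)
  simpa [add_mul, Finset.sum_add_distrib] using this

theorem weightIdeal_pow_le (w : σ → ℕ) (n r : ℕ) :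
    weightIdeal K w n ^ r ≤ weightIdeal K w (r * n) := by
  induction r with
  | zero => intro f _ a _; simp
  | succ r ih =>
    rw [pow_succ, add_mul, one_mul]
    exact (Ideal.mul_mono_left ih).trans (weightIdeal_mul_le w _ _)

end weightIdeal

section ptIdeal

open MvPolynomial

variable {K : Type*} [Field K] {N : ℕ}

theorem ptIdeal_le_weightIdeal (j : Fin (N + 1)) :
    ptIdeal K N j ≤ weightIdeal K (fun i => if i = j then 0 else 1) 1 := by
  refine Ideal.span_le.2 ?_
  rintro _ ⟨i, hij, rfl⟩ a ha
  rw [support_X, Finset.mem_singleton] at ha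
  subst ha
  refine le_trans ?_ (Finset.single_le_sum (fun _ _ => Nat.zero_le _) (Finset.mem_univ i))
  simp [hij]

theorem sum_of_mem_ptIdeal_pow {j : Fin (N + 1)} {n : ℕ} {f : MvPolynomial (Fin (N + 1)) K}
    (hf : f ∈ ptIdeal K N j ^ n) {a : Fin (N + 1) →₀ ℕ} (ha : a ∈ f.support) :
    n ≤ ∑ i ∈ Finset.univ.erase j, a i := by
  have h := weightIdeal_pow_le _ _ _ (Ideal.pow_right_mono (ptIdeal_le_weightIdeal j) n hf) a ha
  rw [mul_one, ← Finset.add_sum_erase _ _ (Finset.mem_univ j)] at h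
  refine h.trans_eq ?_
  simp only [if_true, mul_zero, zero_add]
  refine Finset.sum_congr rfl fun i hi => ?_
  simp [Finset.ne_of_mem_erase hi]

theorem monomial_mem_ptIdeal_pow {j : Fin (N + 1)} {n : ℕ} {a : Fin (N + 1) →₀ ℕ}
    (h : n ≤ ∑ i ∈ Finset.univ.erase j, a i) :
    monomial a (1 : K) ∈ ptIdeal K N j ^ n := by
  rw [monomial_eq, C_1, one_mul, Finsupp.prod_fintype _ _ (fun _ => pow_zero _),
    ← Finset.mul_prod_erase _ _ (Finset.mem_univ j)]
  refine Ideal.mul_mem_left _ _ (Ideal.pow_le_pow_right h ?_)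
  rw [← Finset.prod_pow_eq_pow_sum]
  refine Ideal.prod_mem_prod fun i hi => Ideal.pow_mem_pow (Ideal.subset_span ?_) _
  exact ⟨i, Finset.ne_of_mem_erase hi, rfl⟩

theorem le_sum_div {j : Fin (N + 1)} {m n r : ℕ} {a : Fin (N + 1) → ℕ} (hr : 0 < r) (hn : 0 < n)
    (hm : (N + 1) * r ≤ m) (h : m * n ≤ ∑ i ∈ Finset.univ.erase j, a i) :
    n ≤ ∑ i ∈ Finset.univ.erase j, a i / r := by
  have h1 : ∑ i ∈ Finset.univ.erase j, a i ≤ ∑ i ∈ Finset.univ.erase j, (r * (a i / r) + r) :=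
    Finset.sum_le_sum fun i _ => by
      have := Nat.div_add_mod (a i) r
      have := Nat.mod_lt (a i) hr
      omega
  rw [Finset.sum_add_distrib, ← Finset.mul_sum, Finset.sum_const,
    Finset.card_erase_of_mem (Finset.mem_univ j), Finset.card_univ, Fintype.card_fin,
    Nat.add_sub_cancel, smul_eq_mul] at h1
  set S := ∑ i ∈ Finset.univ.erase j, a i / r
  have h2 : r * ((N + 1) * n) ≤ r * (S + N) := by nlinarith [Nat.mul_le_mul_right n hm]
  have h3 := Nat.le_of_mul_le_mul_left h2 hr
  nlinarith

/-- If `m ≥ (N + 1) r` then `I^{(m)} ⊆ I^r`: each monomial `x^a` of `I^{(m)}` is a multiple of the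
`r`-th power of the monomial with exponents `⌊a_i / r⌋`, which lies in `I`. -/
theorem symbolic_le_pow {p q t : Fin (N + 1)} {m0 m1 m2 m r : ℕ} (h0 : 0 < m0) (h1 : 0 < m1)
    (h2 : 0 < m2) (hr : 0 < r) (hm : (N + 1) * r ≤ m) :
    ptIdeal K N p ^ (m * m0) ⊓ ptIdeal K N q ^ (m * m1) ⊓ ptIdeal K N t ^ (m * m2) ≤
      (ptIdeal K N p ^ m0 ⊓ ptIdeal K N q ^ m1 ⊓ ptIdeal K N t ^ m2) ^ r := by
  rintro f ⟨⟨hf0, hf1⟩, hf2⟩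
  rw [f.as_sum]
  refine Ideal.sum_mem _ fun a ha => ?_
  let b : Fin (N + 1) →₀ ℕ := Finsupp.equivFunOnFinite.symm fun i => a i / r
  let c : Fin (N + 1) →₀ ℕ := Finsupp.equivFunOnFinite.symm fun i => a i % r
  have hac : a = r • b + c := by
    ext i
    simp [b, c, Nat.div_add_mod]
  have hmon : monomial a (coeff a f) = monomial c (coeff a f) * monomial b (1 : K) ^ r := by
    rw [monomial_pow, monomial_mul, one_pow, mul_one, add_comm c, ← hac]
  rw [hmon]
  refine Ideal.mul_mem_left _ _ (Ideal.pow_mem_pow (Ideal.mem_inf.2 ⟨Ideal.mem_inf.2 ⟨?_, ?_⟩, ?_⟩) r)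
  · exact monomial_mem_ptIdeal_pow (le_sum_div hr h0 hm (sum_of_mem_ptIdeal_pow hf0 ha))
  · exact monomial_mem_ptIdeal_pow (le_sum_div hr h1 hm (sum_of_mem_ptIdeal_pow hf1 ha))
  · exact monomial_mem_ptIdeal_pow (le_sum_div hr h2 hm (sum_of_mem_ptIdeal_pow hf2 ha))

/-- If three multiplicities satisfy the triangle inequality and have sum `2 * d - 1`,
then `I^{(2t)} ⊄ I^r` as soon as `t * (2 * d - 1) < r * d`. -/
theorem not_symbolic_le_pow {p q u : Fin (N + 1)} (hpq : p ≠ q) (hpu : p ≠ u) (hqu : q ≠ u)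
    {m0 m1 m2 d t r : ℕ} (h0 : m0 ≤ m1 + m2) (h1 : m1 ≤ m0 + m2) (h2 : m2 ≤ m0 + m1)
    (hd : m0 + m1 + m2 + 1 = 2 * d) (ht : t * (m0 + m1 + m2) < r * d) :
    ¬ ptIdeal K N p ^ (2 * t * m0) ⊓ ptIdeal K N q ^ (2 * t * m1) ⊓
        ptIdeal K N u ^ (2 * t * m2) ≤
      (ptIdeal K N p ^ m0 ⊓ ptIdeal K N q ^ m1 ⊓ ptIdeal K N u ^ m2) ^ r := by
  intro hle
  let w : Fin (N + 1) → ℕ := fun i => if i = p ∨ i = q ∨ i = u then 1 else 2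
  have hw (a : Fin (N + 1) →₀ ℕ) : (∑ i, a i * w i) + (a p + a q + a u) = 2 * ∑ i, a i := by
    have e (j : Fin (N + 1)) : a j = ∑ i, if i = j then a i else 0 := by simp
    rw [e p, e q, e u, ← Finset.sum_add_distrib, ← Finset.sum_add_distrib,
      ← Finset.sum_add_distrib, Finset.mul_sum]
    refine Finset.sum_congr rfl fun i _ => ?_
    by_cases hp : i = p
    · subst hp; simp [w, hpq, hpu]; ring
    by_cases hq : i = q
    · subst hq; simp [w, hp, hqu]; ring
    by_cases hu : i = u
    · subst hu; simp [w, hp, hq]; ring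
    simp [w, hp, hq, hu]; ring
  have hsum (a : Fin (N + 1) →₀ ℕ) (j : Fin (N + 1)) :
      a j + ∑ i ∈ Finset.univ.erase j, a i = ∑ i, a i :=
    Finset.add_sum_erase _ (fun i => a i) (Finset.mem_univ j)
  have hI : ptIdeal K N p ^ m0 ⊓ ptIdeal K N q ^ m1 ⊓ ptIdeal K N u ^ m2 ≤ weightIdeal K w d := by
    rintro f ⟨⟨hf0, hf1⟩, hf2⟩ a ha
    have := sum_of_mem_ptIdeal_pow hf0 ha
    have := sum_of_mem_ptIdeal_pow hf1 ha
    have := sum_of_mem_ptIdeal_pow hf2 ha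
    have := hsum a p
    have := hsum a q
    have := hsum a u
    have := hw a
    have hge : a p + a q + a u ≤ ∑ i, a i := by
      rw [← Finset.sum_erase_add _ _ (Finset.mem_univ u),
        ← Finset.sum_erase_add _ _ (Finset.mem_erase.2 ⟨hqu, Finset.mem_univ q⟩),
        ← Finset.sum_erase_add _ _ (Finset.mem_erase.2 ⟨hpq, Finset.mem_erase.2
          ⟨hpu, Finset.mem_univ p⟩⟩)]
      omega
    omega
  obtain ⟨x, hx⟩ := Nat.exists_eq_add_of_le h0
  obtain ⟨y, hy⟩ := Nat.exists_eq_add_of_le h1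
  obtain ⟨z, hz⟩ := Nat.exists_eq_add_of_le h2
  let e : Fin (N + 1) →₀ ℕ :=
    Finsupp.single p (t * x) + Finsupp.single q (t * y) + Finsupp.single u (t * z)
  have ep : e p = t * x := by simp [e, hpq.symm, hpu.symm]
  have eq : e q = t * y := by simp [e, hpq, hqu.symm]
  have eu : e u = t * z := by simp [e, hpu, hqu]
  have es : ∑ i, e i = t * x + t * y + t * z := by
    simp [e, Finset.sum_add_distrib, Finsupp.single_apply]
  have hyz : y + z = 2 * m0 := by omega
  have hxz : x + z = 2 * m1 := by omega
  have hxy : x + y = 2 * m2 := by omega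
  have hmem : monomial e (1 : K) ∈ ptIdeal K N p ^ (2 * t * m0) ⊓
      ptIdeal K N q ^ (2 * t * m1) ⊓ ptIdeal K N u ^ (2 * t * m2) := by
    refine ⟨⟨monomial_mem_ptIdeal_pow ?_, monomial_mem_ptIdeal_pow ?_⟩,
      monomial_mem_ptIdeal_pow ?_⟩
    · have := hsum e p
      have : 2 * t * m0 = t * y + t * z := by rw [← mul_add, hyz]; ring
      omega
    · have := hsum e q
      have : 2 * t * m1 = t * x + t * z := by rw [← mul_add, hxz]; ring
      omega
    · have := hsum e u
      have : 2 * t * m2 = t * x + t * y := by rw [← mul_add, hxy]; ring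
      omega
  have hfin := weightIdeal_pow_le w d r (Ideal.pow_right_mono hI r (hle hmem)) e
    (by simp)
  have hwe := hw e
  have : t * (m0 + m1 + m2) = t * x + t * y + t * z := by
    rw [← mul_add, ← mul_add]; congr 1; omega
  omega

end ptIdeal

/-- For `Z = m_0 P_0 + m_1 P_1 + m_2 P_2` at three noncollinear (coordinate) points of `P^N`
with `m_0 ≤ m_1 ≤ m_2`, if `m_0 + m_1 > m_2` and `m_0 + m_1 + m_2` is odd, then
`ρ(I(Z)) ≥ (m_0 + m_1 + m_2 + 1)/(m_0 + m_1 + m_2)`. -/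
theorem three_points_resurgence_lower_bound
    (K : Type*) [Field K] (N : ℕ) (hN : 2 ≤ N) (m0 m1 m2 : ℕ)
    (h01 : m0 ≤ m1) (h12 : m1 ≤ m2)
    (hgt : m2 < m0 + m1) (hodd : Odd (m0 + m1 + m2)) :
    ((m0 : ℝ) + m1 + m2 + 1) / ((m0 : ℝ) + m1 + m2) ≤
      resurgence (ptIdeal K N 0 ^ m0 ⊓ ptIdeal K N 1 ^ m1 ⊓ ptIdeal K N 2 ^ m2)
        (fun m =>
          ptIdeal K N 0 ^ (m * m0) ⊓ ptIdeal K N 1 ^ (m * m1) ⊓ ptIdeal K N 2 ^ (m * m2)) := by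
  have hp0 : 0 < m0 := by omega
  have hp1 : 0 < m1 := by omega
  have hp2 : 0 < m2 := by omega
  obtain ⟨c, hc⟩ := hodd
  have hs : (0 : ℝ) < (m0 : ℝ) + m1 + m2 := by positivity
  refine le_of_forall_pos_le_add fun ε hε => ?_
  obtain ⟨k, hk⟩ := exists_nat_gt (1 / ε)
  have hkR : (0 : ℝ) < k := (by positivity : 0 < 1 / ε).trans hk
  have hk0 : 0 < k := by exact_mod_cast hkR
  obtain ⟨t, ht⟩ : ∃ t, k * (m0 + m1 + m2 + 1) = t + 1 :=
    Nat.exists_eq_succ_of_ne_zero (by positivity)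
  have htR : (k : ℝ) * (m0 + m1 + m2 + 1) = t + 1 := by exact_mod_cast ht
  have ht0 : 0 < t := by nlinarith
  have hle : ((2 * t : ℕ) : ℝ) / ((2 * k * (m0 + m1 + m2) : ℕ) : ℝ) ≤
      resurgence (ptIdeal K N 0 ^ m0 ⊓ ptIdeal K N 1 ^ m1 ⊓ ptIdeal K N 2 ^ m2)
        (fun m =>
          ptIdeal K N 0 ^ (m * m0) ⊓ ptIdeal K N 1 ^ (m * m1) ⊓ ptIdeal K N 2 ^ (m * m2)) := by
    refine le_csSup ⟨(N : ℝ) + 1, ?_⟩ ⟨2 * t, 2 * k * (m0 + m1 + m2), by positivity,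
      by positivity, ?_, rfl⟩
    · rintro _ ⟨m, r, -, hr, hmr, rfl⟩
      rw [div_le_iff₀ (by exact_mod_cast hr)]
      by_contra! hlt
      exact hmr (symbolic_le_pow hp0 hp1 hp2 hr (by exact_mod_cast hlt.le))
    · obtain ⟨n, rfl⟩ := Nat.exists_eq_add_of_le' hN
      have h2mod : 2 % (n + 2 + 1) = 2 := Nat.mod_eq_of_lt (by omega)
      refine not_symbolic_le_pow (d := c + 1) (by simp)
        (by simp [Fin.ext_iff, h2mod]) (by simp [Fin.ext_iff, h2mod])
        (by omega) (by omega) (by omega) (by omega) ?_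
      have h2 : 2 * k * (m0 + m1 + m2) * (c + 1) = (t + 1) * (m0 + m1 + m2) := by
        rw [← ht, hc]; ring
      rw [h2]
      exact Nat.mul_lt_mul_of_pos_right (Nat.lt_succ_self t) (by positivity)
  have hs1 : (1 : ℝ) ≤ (m0 : ℝ) + m1 + m2 := by
    exact_mod_cast (by omega : 1 ≤ m0 + m1 + m2)
  have hkε : 1 < k * ε := (div_lt_iff₀ hε).1 hk
  have heq : ((m0 : ℝ) + m1 + m2 + 1) / ((m0 : ℝ) + m1 + m2) =
      ((2 * t : ℕ) : ℝ) / ((2 * k * (m0 + m1 + m2) : ℕ) : ℝ) +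
        1 / (k * ((m0 : ℝ) + m1 + m2)) := by
    push_cast
    field_simp
    linarith
  have hsmall : 1 / (k * ((m0 : ℝ) + m1 + m2)) ≤ ε := by
    rw [div_le_iff₀ (by positivity)]
    nlinarith
  rw [heq]
  exact add_le_add hle hsmall
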